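/- arXiv:1905.13474 — 4 statements merged into one kernel-verified Lean document; each statement's English description precedes it below -/
import Mathlib

section
/- Let d ≥ 1 and let q_i (1 ≤ i ≤ 2^{d+1}−2) be a non-initial state of the cyclic tree automaton of depth d, with depth d_i. If the labeling ℓ is chosen uniformly at random from all functions {0,…,2^{d+1}−2} → {0,1} and the challenge word C is chosen uniformly at random from {0,1}^d, independently of ℓ, then the probability that A(C) = A_{q_i}(C) equals 1 − 1/2^{d_i} + 1/2^{d+1}. -/
/-- Transition function of the cyclic tree automaton of depth `d`:
internal states `s ≤ 2^d − 2` go to children `2s+1` / `2s+2`,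
leaf states go back to `1` / `2`. -/
def delta (d : ℕ) (s : ℕ) (b : Bool) : ℕ :=
  if s + 1 < 2 ^ d then 2 * s + (if b then 2 else 1) else if b then 2 else 1

/-- Transition function of the automaton pruned at state `i`:
every transition into `i` is redirected to the sibling transition. -/
def deltaP (d i : ℕ) (s : ℕ) (b : Bool) : ℕ :=
  if delta d s b = i then delta d s (!b) else delta d s b

/-- The states `s_1, …, s_n` visited after the start state by the run
of a challenge word, for a generic transition function `f`. -/
def visited (f : ℕ → Bool → ℕ) : ℕ → List Bool → List ℕ
  | _, [] => []
  | s, b :: bs => f s b :: visited f (f s b) bs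

/-- The full run `s_0, s_1, …, s_n` from state `s`. -/
def run (f : ℕ → Bool → ℕ) (s : ℕ) (C : List Bool) : List ℕ :=
  s :: visited f s C

/-- The final state of the run from `s`. -/
def runEnd (f : ℕ → Bool → ℕ) (s : ℕ) (C : List Bool) : ℕ :=
  C.foldl f s

/-- Output word `ℓ(s_1)⋯ℓ(s_n)` of the cyclic tree automaton. -/
def out (d : ℕ) (ℓ : ℕ → Bool) (C : List Bool) : List Bool :=
  (visited (delta d) 0 C).map ℓ

/-- Output word of the pruned automaton. -/
def outP (d i : ℕ) (ℓ : ℕ → Bool) (C : List Bool) : List Bool :=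
  (visited (deltaP d i) 0 C).map ℓ

/-- Interpret a labeling of the finite state set `{0,…,N−1}` as a labeling of `ℕ`. -/
def toLabel (N : ℕ) (ℓ : Fin N → Bool) : ℕ → Bool :=
  fun s => if h : s < N then ℓ ⟨s, h⟩ else false

lemma half_count (N a b : ℕ) (ha : a < N) (hab : a ≠ b) (P : (ℕ → Bool) → Prop) [DecidablePred P]
    (hP : ∀ l l' : ℕ → Bool, (∀ x, x ≠ a → l x = l' x) → P l → P l') :
    2 * ((Finset.univ : Finset (Fin N → Bool)).filter
      (fun l => toLabel N l a = toLabel N l b ∧ P (toLabel N l))).card =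
    ((Finset.univ : Finset (Fin N → Bool)).filter (fun l => P (toLabel N l))).card := by
  classical
  have key : ((Finset.univ : Finset (Fin N → Bool)).filter
      (fun l => toLabel N l a = toLabel N l b ∧ P (toLabel N l))).card =
      ((Finset.univ : Finset (Fin N → Bool)).filter
      (fun l => ¬ toLabel N l a = toLabel N l b ∧ P (toLabel N l))).card := by
    let f : (Fin N → Bool) → (Fin N → Bool) := fun l => Function.update l ⟨a, ha⟩ (!(l ⟨a, ha⟩))
    have hff : ∀ l, f (f l) = l := by
      intro l
      simp [f]
    have h1 : ∀ l x, x ≠ a → toLabel N (f l) x = toLabel N l x := by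
      intro l x hx
      simp only [toLabel, f]
      split_ifs with h
      · rw [Function.update_of_ne]
        simpa [Fin.ext_iff] using hx
      · rfl
    have h2 : ∀ l, toLabel N (f l) a = !(toLabel N l a) := by
      intro l
      simp [toLabel, f, ha]
    have h3 : ∀ l, P (toLabel N l) → P (toLabel N (f l)) := fun l h =>
      hP _ _ (fun x hx => (h1 l x hx).symm) h
    refine Finset.card_bij' (fun l _ => f l) (fun l _ => f l) ?_ ?_ ?_ ?_
    · intro l hl
      simp only [Finset.mem_filter, Finset.mem_univ, true_and] at hl ⊢
      refine ⟨?_, h3 l hl.2⟩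
      rw [h2, h1 l b hab.symm, hl.1]
      simp
    · intro l hl
      simp only [Finset.mem_filter, Finset.mem_univ, true_and] at hl ⊢
      refine ⟨?_, h3 l hl.2⟩
      rw [h2, h1 l b hab.symm]
      have := hl.1
      revert this
      cases toLabel N l a <;> cases toLabel N l b <;> simp
    · intro l _; exact hff l
    · intro l _; exact hff l
  rw [two_mul]
  nth_rewrite 2 [key]
  rw [← Finset.card_union_of_disjoint]
  · congr 1
    ext l
    simp only [Finset.mem_union, Finset.mem_filter, Finset.mem_univ, true_and]
    tauto
  · rw [Finset.disjoint_left]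
    intro l
    simp only [Finset.mem_filter, Finset.mem_univ, true_and]
    tauto

lemma inv_lt (d s n : ℕ) (h : (s + 2) * 2 ^ (n + 1) ≤ 2 ^ (d + 1)) : s + 1 < 2 ^ d := by
  have h1 : 1 ≤ 2 ^ n := Nat.one_le_two_pow
  rw [pow_succ, pow_succ] at h
  nlinarith

lemma delta_in (d s n : ℕ) (b : Bool) (h : (s + 2) * 2 ^ (n + 1) ≤ 2 ^ (d + 1)) :
    delta d s b = 2 * s + (if b then 2 else 1) := by
  simp [delta, inv_lt d s n h]

lemma inv_step (d s n : ℕ) (b : Bool) (h : (s + 2) * 2 ^ (n + 1) ≤ 2 ^ (d + 1)) :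
    (delta d s b + 2) * 2 ^ n ≤ 2 ^ (d + 1) := by
  rw [delta_in d s n b h]
  refine le_trans ?_ h
  rw [pow_succ, mul_comm (2 ^ n) 2, ← mul_assoc]
  apply Nat.mul_le_mul_right
  split_ifs <;> omega

lemma visited_gt (d : ℕ) (C : List Bool) : ∀ s, (s + 2) * 2 ^ C.length ≤ 2 ^ (d + 1) →
    ∀ x ∈ visited (delta d) s C, 2 * s + 1 ≤ x := by
  induction C with
  | nil => intro s _ x hx; simp [visited] at hx
  | cons b C ih =>
    intro s h x hx
    simp only [List.length_cons] at h
    have hs := delta_in d s _ b h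
    have hh : 2 * s + 1 ≤ delta d s b := by rw [hs]; split_ifs <;> omega
    simp only [visited, List.mem_cons] at hx
    rcases hx with hx | hx
    · omega
    · have := ih _ (inv_step d s _ b h) x hx
      omega

lemma visited_miss (d i : ℕ) (C : List Bool) : ∀ s, (s + 2) * 2 ^ C.length ≤ 2 ^ (d + 1) →
    (∀ j, (i + 1) / 2 ^ j ≠ s + 1) → visited (deltaP d i) s C = visited (delta d) s C := by
  induction C with
  | nil => intro s _ _; rfl
  | cons b C ih =>
    intro s h hm
    simp only [List.length_cons] at h
    have hs := delta_in d s _ b h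
    have hm' : ∀ j, (i + 1) / 2 ^ j ≠ delta d s b + 1 := by
      intro j hj
      apply hm (j + 1)
      rw [pow_succ, ← Nat.div_div_eq_div_mul, hj, hs]
      split_ifs <;> omega
    have hne : delta d s b ≠ i := by
      intro h0
      apply hm' 0
      simp [h0]
    have : deltaP d i s b = delta d s b := by simp [deltaP, hne]
    simp only [visited, this]
    rw [ih _ (inv_step d s _ b h) hm']

lemma pair_count (d : ℕ) (C : List Bool) : ∀ s t, (s + 2) * 2 ^ C.length ≤ 2 ^ (d + 1) →
    (t + 2) * 2 ^ C.length ≤ 2 ^ (d + 1) → s ≠ t → s ≤ 2 * t →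
    2 ^ (C.length + 1) * ((Finset.univ : Finset (Fin (2 ^ (d + 1) - 1) → Bool)).filter
      (fun l => (s :: visited (delta d) s C).map (toLabel _ l) =
        (t :: visited (delta d) t C).map (toLabel _ l))).card = 2 ^ (2 ^ (d + 1) - 1) := by
  induction C with
  | nil =>
    intro s t hs ht hne hst
    have := half_count (2 ^ (d + 1) - 1) s t (by simp at hs; omega) hne (fun _ => True)
      (by simp)
    simpa [visited] using this
  | cons b C ih =>
    intro s t hs ht hne hst
    have hsN : s < 2 ^ (d + 1) - 1 := by
      have h1 : 1 ≤ 2 ^ (b :: C).length := Nat.one_le_two_pow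
      have : s + 2 ≤ 2 ^ (d + 1) := by nlinarith
      omega
    have hh := half_count (2 ^ (d + 1) - 1) s t hsN hne
      (fun l => (visited (delta d) s (b :: C)).map l = (visited (delta d) t (b :: C)).map l)
      (by
        intro l l' hl h
        have e1 : (visited (delta d) s (b :: C)).map l = (visited (delta d) s (b :: C)).map l' := by
          apply List.map_congr_left
          intro x hx
          apply hl
          have := visited_gt d _ s hs x hx
          omega
        have e2 : (visited (delta d) t (b :: C)).map l = (visited (delta d) t (b :: C)).map l' := by
          apply List.map_congr_left
          intro x hx
          apply hl
          have := visited_gt d _ t ht x hx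
          omega
        rw [← e1, ← e2]; exact h)
    simp only [List.length_cons] at hs ht
    have e1 := delta_in d s _ b hs
    have e2 := delta_in d t _ b ht
    have hI := ih (delta d s b) (delta d t b) (inv_step d s _ b hs) (inv_step d t _ b ht)
      (by rw [e1, e2]; omega) (by rw [e1, e2]; split_ifs <;> omega)
    rw [← hI, List.length_cons, pow_succ, mul_assoc]
    congr 1
    refine Eq.trans ?_ (hh.trans ?_)
    · congr 2
      ext l
      simp only [Finset.mem_filter, Finset.mem_univ, true_and, List.map_cons, List.cons.injEq]
    · congr 1

/-- number of labelings on which the two runs agree -/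
def cnt (d i s : ℕ) (C : List Bool) : ℕ :=
  ((Finset.univ : Finset (Fin (2 ^ (d + 1) - 1) → Bool)).filter
      (fun l => (visited (delta d) s C).map (toLabel _ l) =
        (visited (deltaP d i) s C).map (toLabel _ l))).card

lemma cnt_miss (d i s : ℕ) (C : List Bool) (h : (s + 2) * 2 ^ C.length ≤ 2 ^ (d + 1))
    (hm : ∀ j, (i + 1) / 2 ^ j ≠ s + 1) : cnt d i s C = 2 ^ (2 ^ (d + 1) - 1) := by
  simp [cnt, visited_miss d i C s h hm]

lemma cnt_step (d i s : ℕ) (b : Bool) (C : List Bool) (h : delta d s b ≠ i) :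
    cnt d i s (b :: C) = cnt d i (delta d s b) C := by
  simp [cnt, visited, deltaP, h]

lemma sib_miss (d i s n j : ℕ) (b : Bool) (h : (s + 2) * 2 ^ (n + 1) ≤ 2 ^ (d + 1))
    (hj : (i + 1) / 2 ^ j = delta d s b + 1) (j' : ℕ) :
    (i + 1) / 2 ^ j' ≠ delta d s (!b) + 1 := by
  intro hj'
  rw [delta_in d s n _ h] at hj hj'
  rcases lt_trichotomy j j' with hl | hl | hl
  · obtain ⟨k, rfl⟩ := Nat.exists_eq_add_of_lt hl
    have h2 : (i + 1) / 2 ^ (j + k + 1) ≤ (i + 1) / 2 ^ j / 2 := by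
      rw [Nat.div_div_eq_div_mul, ← pow_succ]
      exact Nat.div_le_div_left (Nat.pow_le_pow_right (by norm_num) (by omega)) (by positivity)
    rw [hj, hj'] at h2
    cases b <;> simp at h2 <;> omega
  · subst hl
    rw [hj] at hj'
    cases b <;> simp at hj'
  · obtain ⟨k, rfl⟩ := Nat.exists_eq_add_of_lt hl
    have h2 : (i + 1) / 2 ^ (j' + k + 1) ≤ (i + 1) / 2 ^ j' / 2 := by
      rw [Nat.div_div_eq_div_mul, ← pow_succ]
      exact Nat.div_le_div_left (Nat.pow_le_pow_right (by norm_num) (by omega)) (by positivity)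
    rw [hj, hj'] at h2
    cases b <;> simp at h2 <;> omega

lemma cnt_hit (d i s : ℕ) (b : Bool) (C : List Bool)
    (h : (s + 2) * 2 ^ (C.length + 1) ≤ 2 ^ (d + 1)) (hi : delta d s b = i) :
    2 ^ (C.length + 1) * cnt d i s (b :: C) = 2 ^ (2 ^ (d + 1) - 1) := by
  have hm := sib_miss d i s _ 0 b h (by simp [hi])
  have hv := visited_miss d i C _ (inv_step d s _ (!b) h) hm
  have hP : deltaP d i s b = delta d s (!b) := by simp [deltaP, hi]
  have e1 := delta_in d s _ b h
  have e2 := delta_in d s _ (!b) h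
  have := pair_count d C (delta d s b) (delta d s (!b)) (inv_step d s _ b h)
    (inv_step d s _ (!b) h) (by rw [e1, e2]; cases b <;> simp)
    (by rw [e1, e2]; cases b <;> simp <;> omega)
  rw [← this]
  simp only [cnt, visited, hP, hv]

lemma sum_split (n : ℕ) (F : List Bool → ℚ) (b : Bool) :
    ∑ c : Fin (n + 1) → Bool, F (List.ofFn c) =
      ∑ c : Fin n → Bool, F (b :: List.ofFn c) + ∑ c : Fin n → Bool, F ((!b) :: List.ofFn c) := by
  rw [← (Fin.consEquiv (fun _ : Fin (n + 1) => Bool)).sum_comp, Fintype.sum_prod_type]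
  have e : ∀ (x : Bool) (y : Fin n → Bool),
      List.ofFn ((Fin.consEquiv (fun _ : Fin (n + 1) => Bool)) (x, y)) = x :: List.ofFn y := by
    intro x y
    exact List.ofFn_cons x y
  simp only [e]
  cases b <;> simp [add_comm]

lemma main_sum (d i : ℕ) (j : ℕ) : ∀ n s, (s + 2) * 2 ^ n ≤ 2 ^ (d + 1) → j + 1 ≤ n →
    (i + 1) / 2 ^ (j + 1) = s + 1 →
    ∑ c : Fin n → Bool, (cnt d i s (List.ofFn c) : ℚ) =
      2 ^ (2 ^ (d + 1) - 1) * 2 ^ n * (1 - 1 / 2 ^ (j + 1) + 1 / 2 ^ (n + 1)) := by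
  induction j with
  | zero =>
    intro n s h hn hj
    obtain ⟨n, rfl⟩ : ∃ m, n = m + 1 := ⟨n - 1, by omega⟩
    obtain ⟨b, hb⟩ : ∃ b, delta d s b = i := by
      rcases Nat.mod_two_eq_zero_or_one i with hh | hh
      · exact ⟨true, by rw [delta_in d s n _ h]; simp at hj ⊢; omega⟩
      · exact ⟨false, by rw [delta_in d s n _ h]; simp at hj ⊢; omega⟩
    have hm := sib_miss d i s _ 0 b h (by simp [hb])
    rw [sum_split n (fun C => (cnt d i s C : ℚ)) b]
    have A : ∀ c : Fin n → Bool, (cnt d i s (b :: List.ofFn c) : ℚ) =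
        2 ^ (2 ^ (d + 1) - 1) / 2 ^ (n + 1) := by
      intro c
      have := cnt_hit d i s b (List.ofFn c) (by simpa using h) hb
      rw [List.length_ofFn] at this
      rw [eq_div_iff (by positivity), mul_comm]
      exact_mod_cast this
    have B : ∀ c : Fin n → Bool, (cnt d i s ((!b) :: List.ofFn c) : ℚ) =
        2 ^ (2 ^ (d + 1) - 1) := by
      intro c
      rw [cnt_step _ _ _ _ _ (by intro h0; apply hm 0; simp [h0]),
        cnt_miss _ _ _ _ (by simpa using inv_step d s n (!b) h) hm]
      push_cast; rfl
    simp only [A, B, Finset.sum_const, Finset.card_univ, Fintype.card_fun, Fintype.card_bool,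
      Fintype.card_fin, nsmul_eq_mul]
    push_cast
    generalize (2 : ℚ) ^ (2 ^ (d + 1) - 1) = M
    field_simp
    ring
  | succ j ih =>
    intro n s h hn hj
    obtain ⟨n, rfl⟩ : ∃ m, n = m + 1 := ⟨n - 1, by omega⟩
    rw [pow_succ, ← Nat.div_div_eq_div_mul] at hj
    obtain ⟨b, hb⟩ : ∃ b, (i + 1) / 2 ^ (j + 1) = delta d s b + 1 := by
      generalize (i + 1) / 2 ^ (j + 1) = x at hj
      rcases Nat.mod_two_eq_zero_or_one x with hh | hh
      · exact ⟨false, by rw [delta_in d s n _ h]; simp; omega⟩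
      · exact ⟨true, by rw [delta_in d s n _ h]; simp; omega⟩
    have hm := sib_miss d i s _ _ b h hb
    have hne : delta d s b ≠ i := by
      intro h0
      rw [h0] at hb
      have : (i + 1) / 2 ^ (j + 1) < i + 1 :=
        Nat.div_lt_self (by omega) (Nat.one_lt_two_pow (by omega))
      omega
    rw [sum_split n (fun C => (cnt d i s C : ℚ)) b]
    have B : ∀ c : Fin n → Bool, (cnt d i s ((!b) :: List.ofFn c) : ℚ) =
        2 ^ (2 ^ (d + 1) - 1) := by
      intro c
      rw [cnt_step _ _ _ _ _ (by intro h0; apply hm 0; simp [h0]),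
        cnt_miss _ _ _ _ (by simpa using inv_step d s n (!b) h) hm]
      push_cast; rfl
    simp only [cnt_step _ _ _ _ _ hne]
    rw [ih n _ (inv_step d s n b h) (by omega) hb]
    simp only [B, Finset.sum_const, Finset.card_univ, Fintype.card_fun, Fintype.card_bool,
      Fintype.card_fin, nsmul_eq_mul]
    push_cast
    generalize (2 : ℚ) ^ (2 ^ (d + 1) - 1) = M
    field_simp
    ring

/-- for `n = d` rounds, a uniformly random labeling and a
uniformly random challenge word of length `d`, the probability that the
cyclic tree automaton and its version pruned at the non-initial state `i`
(of depth `di = Nat.log 2 (i+1)`) give the same output is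
`1 - 1/2^di + 1/2^(d+1)`. -/
theorem stmt1 (d i di : ℕ) (hd : 1 ≤ d)
    (hi1 : 1 ≤ i) (hi2 : i ≤ 2 ^ (d + 1) - 2)
    (hdi : di = Nat.log 2 (i + 1)) :
    (((Finset.univ : Finset ((Fin (2 ^ (d + 1) - 1) → Bool) × (Fin d → Bool))).filter
        (fun p => out d (toLabel (2 ^ (d + 1) - 1) p.1) (List.ofFn p.2) =
          outP d i (toLabel (2 ^ (d + 1) - 1) p.1) (List.ofFn p.2))).card : ℚ) /
      (((Finset.univ : Finset ((Fin (2 ^ (d + 1) - 1) → Bool) × (Fin d → Bool))).card : ℚ)) =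
      1 - 1 / 2 ^ di + 1 / 2 ^ (d + 1) := by
  have h0 : i + 1 ≠ 0 := by omega
  have hlo : 2 ^ di ≤ i + 1 := by rw [hdi]; exact Nat.pow_log_le_self 2 h0
  have hhi : i + 1 < 2 ^ (di + 1) := by rw [hdi]; exact Nat.lt_pow_succ_log_self (by norm_num) _
  have hdi1 : 1 ≤ di := by
    by_contra hc
    have : di = 0 := by omega
    subst this
    simp at hhi
    omega
  have hdd : di ≤ d := by
    by_contra hc
    have : 2 ^ (d + 1) ≤ 2 ^ di := Nat.pow_le_pow_right (by norm_num) (by omega)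
    have : 1 ≤ 2 ^ (d + 1) := Nat.one_le_two_pow
    omega
  obtain ⟨j, rfl⟩ : ∃ j, di = j + 1 := ⟨di - 1, by omega⟩
  have hq : (i + 1) / 2 ^ (j + 1) = 0 + 1 := by
    apply Nat.div_eq_of_lt_le
    · simpa using hlo
    · rw [pow_succ] at hhi; omega
  have hmain := main_sum d i j d 0 (by rw [pow_succ]; omega) hdd hq
  have hcard : (((Finset.univ : Finset ((Fin (2 ^ (d + 1) - 1) → Bool) × (Fin d → Bool))).filter
        (fun p => out d (toLabel (2 ^ (d + 1) - 1) p.1) (List.ofFn p.2) =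
          outP d i (toLabel (2 ^ (d + 1) - 1) p.1) (List.ofFn p.2))).card) =
      ∑ c : Fin d → Bool, cnt d i 0 (List.ofFn c) := by
    rw [Finset.card_filter, Fintype.sum_prod_type_right]
    apply Finset.sum_congr rfl
    intro c _
    rw [cnt, Finset.card_filter]
    rfl
  rw [hcard]
  push_cast
  rw [hmain]
  simp only [Finset.card_univ, Fintype.card_prod, Fintype.card_fun, Fintype.card_bool,
      Fintype.card_fin]
  push_cast
  rw [mul_div_assoc, mul_comm, div_mul_cancel₀]
  positivity
end

section
/- Let d ≥ 1 and let q_i (1 ≤ i ≤ 2^{d+1}−2) be a non-initial state of the cyclic tree automaton of depth d, with depth d_i and access word π_i ∈ {0,1}^{d_i}. For every labeling ℓ and every challenge word C ∈ {0,1}^d whose prefix of length d_i is different from π_i, the output of the cyclic tree automaton A on C equals the output of the pruned automaton A_{q_i} on C, i.e., A(C) = A_{q_i}(C). -/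
theorem delta_level (d k s : ℕ) (b : Bool) (hk : k + 1 ≤ d) (h1 : 2 ^ k ≤ s + 1)
    (h2 : s + 1 < 2 ^ (k + 1)) :
    delta d s b = 2 * s + (if b then 2 else 1) ∧
    2 ^ (k + 1) ≤ delta d s b + 1 ∧ delta d s b + 1 < 2 ^ (k + 1 + 1) := by
  have h3 : 2 ^ (k + 1) ≤ 2 ^ d := Nat.pow_le_pow_right (by norm_num) hk
  have h4 : delta d s b = 2 * s + (if b then 2 else 1) := by
    unfold delta
    rw [if_pos (by omega)]
  refine ⟨h4, ?_⟩
  rw [h4]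
  rw [pow_succ] at h2
  rw [pow_succ, pow_succ]
  cases b <;> simp <;> omega

theorem fold_level (d : ℕ) (w : List Bool) : ∀ (k s : ℕ), k + w.length ≤ d → 2 ^ k ≤ s + 1 →
    s + 1 < 2 ^ (k + 1) →
    2 ^ (k + w.length) ≤ w.foldl (delta d) s + 1 ∧
      w.foldl (delta d) s + 1 < 2 ^ (k + w.length + 1) := by
  induction w with
  | nil => intro k s _ h1 h2; exact ⟨h1, h2⟩
  | cons b w ih =>
    intro k s hk h1 h2
    simp only [List.length_cons] at hk
    obtain ⟨_, h5, h6⟩ := delta_level d k s b (by omega) h1 h2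
    have := ih (k + 1) (delta d s b) (by omega) h5 h6
    simp only [List.length_cons, List.foldl_cons]
    rwa [show k + (w.length + 1) = k + 1 + w.length by omega]

theorem fold_inj (d : ℕ) (w : List Bool) : ∀ (w' : List Bool) (k s s' : ℕ),
    w.length = w'.length → k + w.length ≤ d → 2 ^ k ≤ s + 1 → s + 1 < 2 ^ (k + 1) →
    2 ^ k ≤ s' + 1 → s' + 1 < 2 ^ (k + 1) →
    w.foldl (delta d) s = w'.foldl (delta d) s' → s = s' ∧ w = w' := by
  induction w with
  | nil =>
    intro w' k s s' hl _ _ _ _ _ h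
    cases w' with
    | nil => exact ⟨h, rfl⟩
    | cons _ _ => simp at hl
  | cons b w ih =>
    intro w' k s s' hl hk h1 h2 h1' h2' h
    cases w' with
    | nil => simp at hl
    | cons b' w' =>
      simp only [List.length_cons] at hk hl
      obtain ⟨h4, h5, h6⟩ := delta_level d k s b (by omega) h1 h2
      obtain ⟨h4', h5', h6'⟩ := delta_level d k s' b' (by omega) h1' h2'
      obtain ⟨e, rfl⟩ := ih w' (k + 1) _ _ (by omega) (by omega) h5 h6 h5' h6' h
      rw [h4, h4'] at e
      cases b <;> cases b' <;> simp at e ⊢ <;> omega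

theorem visited_eq (d i : ℕ) (C : List Bool) : ∀ s : ℕ,
    (∀ n, 1 ≤ n → n ≤ C.length → (C.take n).foldl (delta d) s ≠ i) →
    visited (delta d) s C = visited (deltaP d i) s C := by
  induction C with
  | nil => intro s _; rfl
  | cons b C ih =>
    intro s h
    have h1 : delta d s b ≠ i := by simpa using h 1 le_rfl (by simp)
    have h2 : deltaP d i s b = delta d s b := by unfold deltaP; rw [if_neg h1]
    simp only [visited, h2]
    rw [ih]
    intro n hn hl
    simpa using h (n + 1) (by omega) (by simpa using hl)

/-- if the prefix of length `di` of the length-`d` challenge word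
`C` differs from the access word `π` of the pruned state `i`, then the
original and pruned automata output the same word on `C`, for every
labeling. -/
theorem stmt2 (d i di : ℕ) (hd : 1 ≤ d)
    (hi1 : 1 ≤ i) (hi2 : i ≤ 2 ^ (d + 1) - 2)
    (hdi : di = Nat.log 2 (i + 1))
    (π : List Bool) (hπlen : π.length = di) (hπ : runEnd (delta d) 0 π = i)
    (ℓ : ℕ → Bool) (C : List Bool) (hC : C.length = d)
    (hpre : C.take di ≠ π) :
    out d ℓ C = outP d i ℓ C := by
  unfold out outP
  rw [visited_eq d i C 0]
  intro n hn hl he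
  have hlen : (C.take n).length = n := by simp [hl]
  have hb := fold_level d (C.take n) 0 0 (by omega) (by simp) (by simp)
  rw [he, hlen, Nat.zero_add] at hb
  have hn' : Nat.log 2 (i + 1) = n := Nat.log_eq_of_pow_le_of_lt_pow hb.1 hb.2
  have hdn : di = n := hdi.trans hn'
  subst hdn
  apply hpre
  exact (fold_inj d (C.take di) π 0 0 0 (by omega) (by omega) (by simp) (by simp) (by simp)
    (by simp) (he.trans hπ.symm)).2
end

section
/- Let d ≥ 1 and let q_i (1 ≤ i ≤ 2^{d+1}−2) be a non-initial state of the cyclic tree automaton of depth d, with depth d_i and access word π_i ∈ {0,1}^{d_i}. For every fixed challenge word C ∈ {0,1}^d whose prefix of length d_i equals π_i, if the labeling ℓ is chosen uniformly at random from all functions {0,…,2^{d+1}−2} → {0,1}, then the probability that A(C) = A_{q_i}(C) equals 1/2^{d−d_i+1}. -/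
def LevelAt (j s : ℕ) : Prop := 2 ^ j ≤ s + 1 ∧ s + 1 < 2 ^ (j + 1)

lemma levelAt_delta {d j s : ℕ} (h : LevelAt j s) (hj : j < d) (b : Bool) :
    LevelAt (j + 1) (delta d s b) := by
  have h2 : 2 ^ (j + 1) ≤ 2 ^ d := Nat.pow_le_pow_right (by norm_num) hj
  unfold LevelAt delta at *
  rw [if_pos (by omega)]
  rw [pow_succ 2 (j + 1), pow_succ 2 j] at *
  cases b <;> simp <;> omega

lemma levelAt_ge {j k s : ℕ} (h : LevelAt j s) (hk : k ≤ j) : 2 ^ k ≤ s + 1 :=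
  (Nat.pow_le_pow_right (by norm_num) hk).trans h.1

lemma levelAt_lt {j k s : ℕ} (h : LevelAt j s) (hk : j < k) : s + 1 < 2 ^ k :=
  h.2.trans_le (Nat.pow_le_pow_right (by norm_num) hk)

lemma levelAt_ne {j k s t : ℕ} (h : LevelAt j s) (h' : LevelAt k t) (hk : j < k) : t ≠ s := by
  have := levelAt_lt h hk
  have := h'.1
  omega

lemma visited_append (f : ℕ → Bool → ℕ) (u v : List Bool) (s : ℕ) :
    visited f s (u ++ v) = visited f s u ++ visited f (runEnd f s u) v := by
  induction u generalizing s with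
  | nil => simp [visited, runEnd]
  | cons b u ih => simp [visited, ih, runEnd]

lemma deltaP_eq {d i di j s : ℕ} (hi : LevelAt di i) (h : LevelAt j s) (hj : j < d)
    (hne : j + 1 ≠ di) (b : Bool) : deltaP d i s b = delta d s b := by
  have h1 := levelAt_delta h hj b
  unfold deltaP
  rw [if_neg]
  rcases lt_or_gt_of_ne hne with h2 | h2
  · exact (levelAt_ne h1 hi h2).symm
  · exact levelAt_ne hi h1 h2

lemma runEnd_level {d : ℕ} (u : List Bool) (j s : ℕ) (h : LevelAt j s) (hj : j + u.length ≤ d) :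
    LevelAt (j + u.length) (runEnd (delta d) s u) := by
  induction u generalizing j s with
  | nil => simpa [runEnd] using h
  | cons b u ih =>
    simp only [List.length_cons] at *
    have := ih (j + 1) (delta d s b) (levelAt_delta h (by omega) b) (by omega)
    rw [show j + (u.length + 1) = j + 1 + u.length by omega]
    simpa [runEnd] using this

lemma prefix_eq {d i di : ℕ} (hi : LevelAt di i) (hdi : di ≤ d) (u : List Bool) (j s : ℕ)
    (h : LevelAt j s) (hj : j + u.length < di) :
    visited (deltaP d i) s u = visited (delta d) s u ∧
      runEnd (deltaP d i) s u = runEnd (delta d) s u := by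
  induction u generalizing j s with
  | nil => simp [visited, runEnd]
  | cons b u ih =>
    simp only [List.length_cons] at *
    have := ih (j + 1) (delta d s b) (levelAt_delta h (by omega) b) (by omega)
    have e := deltaP_eq (d := d) hi h (by omega) (by omega) b
    simp only [visited, runEnd, List.foldl_cons, e] at *
    simp [this]

lemma suffix_eq {d i di : ℕ} (hi : LevelAt di i) (u : List Bool) (j s : ℕ)
    (h : LevelAt j s) (hj : j + u.length ≤ d) (hdi : di ≤ j) :
    visited (deltaP d i) s u = visited (delta d) s u := by
  induction u generalizing j s with
  | nil => simp [visited]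
  | cons b u ih =>
    simp only [List.length_cons] at *
    have := ih (j + 1) (delta d s b) (levelAt_delta h (by omega) b) (by omega) (by omega)
    have e := deltaP_eq (d := d) hi h (by omega) (by omega) b
    simp [visited, e, this]

def GoodPair (N : ℕ) : List ℕ → List ℕ → Prop
  | [], [] => True
  | x :: xs, y :: ys => x ≠ y ∧ y < N ∧ y ∉ xs ∧ y ∉ ys ∧ GoodPair N xs ys
  | _, _ => False

lemma visited_level {d : ℕ} (u : List Bool) (j s : ℕ)
    (h : LevelAt j s) (hj : j + u.length ≤ d) : ∀ x ∈ visited (delta d) s u, 2 ^ (j + 1) ≤ x + 1 := by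
  induction u generalizing j s with
  | nil => simp [visited]
  | cons b u ih =>
    simp only [List.length_cons] at *
    have h1 := levelAt_delta (d := d) h (by omega) b
    intro x hx
    simp only [visited, List.mem_cons] at hx
    rcases hx with rfl | hx
    · exact h1.1
    · have := ih (j + 1) _ h1 (by omega) x hx
      rw [pow_succ] at this
      omega

lemma good_visited {d : ℕ} (u : List Bool) (j s t : ℕ)
    (hs : LevelAt j s) (ht : LevelAt j t) (hne : s ≠ t) (hj : j + u.length ≤ d) :
    GoodPair (2 ^ (d + 1) - 1) (s :: visited (delta d) s u) (t :: visited (delta d) t u) := by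
  have hN := levelAt_lt ht (show j < d + 1 by omega)
  have a1 := visited_level u j s hs hj
  have a2 := visited_level u j t ht hj
  have h2 := ht.2
  refine ⟨hne, by omega, fun hm => ?_, fun hm => ?_, ?_⟩
  · have := a1 _ hm
    omega
  · have := a2 _ hm
    omega
  · clear a1 a2
    induction u generalizing j s t with
    | nil => simp [visited, GoodPair]
    | cons b u ih =>
      simp only [List.length_cons] at *
      have hs' := levelAt_delta (d := d) hs (by omega) b
      have ht' := levelAt_delta (d := d) ht (by omega) b
      have hne' : delta d s b ≠ delta d t b := by
        have q1 := levelAt_lt hs (show j < d by omega)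
        have q2 := levelAt_lt ht (show j < d by omega)
        unfold delta
        rw [if_pos q1, if_pos q2]
        omega
      have hN' := levelAt_lt ht' (show j + 1 < d + 1 by omega)
      have a1 := visited_level (d := d) u (j + 1) _ hs' (by omega)
      have a2 := visited_level (d := d) u (j + 1) _ ht' (by omega)
      have h2' := ht'.2
      refine ⟨hne', by omega, fun hm => ?_, fun hm => ?_, ?_⟩
      · have := a1 _ hm
        omega
      · have := a2 _ hm
        omega
      · exact ih (j + 1) _ _ hs' ht' hne' (by omega) hN' h2'

lemma toLabel_update {N y x : ℕ} (hy : y < N) (l : Fin N → Bool) (v : Bool) (h : x ≠ y) :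
    toLabel N (Function.update l ⟨y, hy⟩ v) x = toLabel N l x := by
  unfold toLabel
  split_ifs with hx
  · rw [Function.update_of_ne]
    simpa using h
  · rfl

lemma count_good (N : ℕ) (xs ys : List ℕ) (h : GoodPair N xs ys) :
    ((Finset.univ : Finset (Fin N → Bool)).filter
      (fun l => xs.map (toLabel N l) = ys.map (toLabel N l))).card * 2 ^ xs.length = 2 ^ N := by
  induction xs generalizing ys with
  | nil =>
    cases ys with
    | nil => simp
    | cons y ys => exact h.elim
  | cons x xs ih =>
    cases ys with
    | nil => exact h.elim
    | cons y ys =>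
      obtain ⟨hne, hy, hx1, hy1, hg⟩ := h
      have IH := ih ys hg
      rw [← Finset.card_filter_add_card_filter_not (fun l => toLabel N l x = toLabel N l y),
        Finset.filter_filter, Finset.filter_filter] at IH
      have upd : ∀ (l : Fin N → Bool) v (zs : List ℕ), y ∉ zs →
          zs.map (toLabel N (Function.update l ⟨y, hy⟩ v)) = zs.map (toLabel N l) := by
        intro l v zs hz
        refine List.map_congr_left fun z hm => toLabel_update hy l v ?_
        rintro rfl
        exact hz hm
      have updy : ∀ (l : Fin N → Bool) v, toLabel N (Function.update l ⟨y, hy⟩ v) y = v := by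
        intro l v
        simp [toLabel, hy]
      have ly : ∀ (l : Fin N → Bool), toLabel N l y = l ⟨y, hy⟩ := by
        intro l
        simp [toLabel, hy]
      have key : ((Finset.univ : Finset (Fin N → Bool)).filter (fun l =>
            xs.map (toLabel N l) = ys.map (toLabel N l) ∧ toLabel N l x = toLabel N l y)).card =
          ((Finset.univ : Finset (Fin N → Bool)).filter (fun l =>
            xs.map (toLabel N l) = ys.map (toLabel N l) ∧ ¬ toLabel N l x = toLabel N l y)).card := by
        refine Finset.card_bij' (fun l _ => Function.update l ⟨y, hy⟩ (!l ⟨y, hy⟩))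
          (fun l _ => Function.update l ⟨y, hy⟩ (!l ⟨y, hy⟩)) ?_ ?_ ?_ ?_
        · intro l hl
          simp only [Finset.mem_filter, Finset.mem_univ, true_and] at hl ⊢
          rw [upd _ _ _ hx1, upd _ _ _ hy1, updy, toLabel_update hy _ _ hne, hl.2, ly]
          exact ⟨hl.1, by simp⟩
        · intro l hl
          simp only [Finset.mem_filter, Finset.mem_univ, true_and] at hl ⊢
          rw [upd _ _ _ hx1, upd _ _ _ hy1, updy, toLabel_update hy _ _ hne]
          rw [ly] at hl
          exact ⟨hl.1, by
            have h3 := hl.2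
            revert h3
            cases toLabel N l x <;> cases l ⟨y, hy⟩ <;> simp⟩
        · intro l hl
          simp
        · intro l hl
          simp
      rw [← key] at IH
      have e : (fun l : Fin N → Bool =>
          (x :: xs).map (toLabel N l) = (y :: ys).map (toLabel N l)) = fun l =>
            xs.map (toLabel N l) = ys.map (toLabel N l) ∧ toLabel N l x = toLabel N l y := by
        funext l
        simp [and_comm]
      simp only [e, List.length_cons]
      rw [← IH]
      ring

/-- if the prefix of length `di` of the fixed length-`d` challenge
word `C` equals the access word `π` of the pruned state `i`, then for a
uniformly random labeling of the `2^(d+1)-1` states the probability that the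
original and pruned automata output the same word on `C` is `1/2^(d-di+1)`. -/
theorem stmt3 (d i di : ℕ) (hd : 1 ≤ d)
    (hi1 : 1 ≤ i) (hi2 : i ≤ 2 ^ (d + 1) - 2)
    (hdi : di = Nat.log 2 (i + 1))
    (π : List Bool) (hπlen : π.length = di) (hπ : runEnd (delta d) 0 π = i)
    (C : List Bool) (hC : C.length = d) (hpre : C.take di = π) :
    (((Finset.univ : Finset (Fin (2 ^ (d + 1) - 1) → Bool)).filter
        (fun ℓ' => out d (toLabel (2 ^ (d + 1) - 1) ℓ') C =
          outP d i (toLabel (2 ^ (d + 1) - 1) ℓ') C)).card : ℚ) /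
      (((Finset.univ : Finset (Fin (2 ^ (d + 1) - 1) → Bool)).card : ℚ)) =
      1 / 2 ^ (d - di + 1) := by
  have hlog : LevelAt di i := by
    subst hdi
    exact ⟨Nat.pow_log_le_self 2 (by omega), Nat.lt_pow_succ_log_self (by norm_num) _⟩
  have hdd : di ≤ d := by
    have := congrArg List.length hpre
    simp at this
    omega
  have hpos : 0 < di := by
    subst hdi
    exact Nat.log_pos (by norm_num) (by omega)
  have hπne : π ≠ [] := by
    rintro rfl
    simp at hπlen
    omega
  obtain ⟨u, b, rfl⟩ : ∃ u b, π = u ++ [b] :=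
    ⟨π.dropLast, π.getLast hπne, (List.dropLast_append_getLast hπne).symm⟩
  obtain ⟨w, hw⟩ : ∃ w, C = u ++ b :: w :=
    ⟨C.drop di, by
      have h3 := List.take_append_drop di C
      rw [hpre] at h3
      rw [← h3]
      simp [← hπlen]⟩
  simp only [List.length_append, List.length_cons, List.length_nil] at hπlen
  have hlen : u.length + (w.length + 1) = d := by
    rw [← hC, hw]
    simp
  have l0 : LevelAt 0 0 := by simp [LevelAt]
  obtain ⟨p1, p2⟩ := prefix_eq (d := d) hlog hdd u 0 0 l0 (by omega)
  have hp := runEnd_level (d := d) u 0 0 l0 (by omega)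
  have hstep : delta d (runEnd (delta d) 0 u) b = i := by
    simpa [runEnd] using hπ
  set p := runEnd (delta d) 0 u with hpdef
  have hstepP : deltaP d i p b = delta d p (!b) := by
    unfold deltaP
    rw [if_pos hstep]
  have ht := levelAt_delta (d := d) hp (by omega) (!b)
  have hne : i ≠ delta d p (!b) := by
    rw [← hstep]
    unfold delta
    cases b <;> simp <;> split_ifs <;> omega
  set t := delta d p (!b) with htdef
  rw [show 0 + u.length + 1 = di by omega] at ht
  have hgood := good_visited (d := d) w di i t hlog ht hne (by omega)
  have hcount := count_good _ _ _ hgood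
  have e : ∀ l : ℕ → Bool, (out d l C = outP d i l C) ↔
      (i :: visited (delta d) i w).map l = (t :: visited (delta d) t w).map l := by
    intro l
    unfold out outP
    rw [hw, visited_append, visited_append, p1, p2, ← hpdef, List.map_append, List.map_append,
      List.append_cancel_left_eq]
    simp only [visited, hstep, hstepP]
    rw [suffix_eq (d := d) hlog w di t ht (by omega) le_rfl]
  simp only [e]
  have hvl : ∀ (f : ℕ → Bool → ℕ) (v : List Bool) s, (visited f s v).length = v.length := by
    intro f v
    induction v with
    | nil => simp [visited]
    | cons b v ih => simp [visited, ih]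
  rw [List.length_cons, hvl, show w.length + 1 = d - di + 1 by omega] at hcount
  have hq := congrArg (Nat.cast : ℕ → ℚ) hcount
  push_cast at hq
  rw [Finset.card_univ, Fintype.card_fun, Fintype.card_bool, Fintype.card_fin]
  push_cast
  rw [div_eq_div_iff (by positivity) (by positivity), one_mul]
  exact hq
end

section
/- Let d ≥ 1. For every labeling ℓ, every positive integer x, every word u ∈ {0,1}^{d·x} and every word v ∈ {0,1}^m with m ≥ 0, the output of the cyclic tree automaton A of depth d on the concatenation u·v equals the concatenation of its outputs on u and on v, i.e., A(u·v) = A(u)·A(v); moreover, the same decomposition holds for every pruned automaton A_{q_i} with 1 ≤ i ≤ 2^{d+1}−2: A_{q_i}(u·v) = A_{q_i}(u)·A_{q_i}(v). -/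
theorem aux_visited_append (f : ℕ → Bool → ℕ) (u v : List Bool) (s : ℕ) :
    visited f s (u ++ v) = visited f s u ++ visited f (u.foldl f s) v := by
  induction u generalizing s with
  | nil => simp [visited]
  | cons b u ih => simp [visited, ih]

theorem aux_visited_congr (f : ℕ → Bool → ℕ) (v : List Bool) (s t : ℕ)
    (h : ∀ b, f s b = f t b) : visited f s v = visited f t v := by
  cases v with
  | nil => simp [visited]
  | cons b v => simp [visited, h]

theorem aux_level (d : ℕ) (f : ℕ → Bool → ℕ) (hf : ∀ s b, ∃ c, f s b = delta d s c)
    (u : List Bool) (s j : ℕ) (h1 : 2 ^ j ≤ s + 1) (h2 : s + 1 < 2 ^ (j + 1))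
    (hj : j + u.length = d) : 2 ^ d ≤ u.foldl f s + 1 := by
  induction u generalizing s j with
  | nil => simp at hj; subst hj; simpa using h1
  | cons b u ih =>
    simp only [List.length_cons] at hj
    have hp : 2 ^ (j + 1) ≤ 2 ^ d := Nat.pow_le_pow_right (by norm_num) (by omega)
    obtain ⟨c, hc⟩ := hf s b
    have hlt : s + 1 < 2 ^ d := by omega
    simp only [delta, hlt, if_true] at hc
    have e1 : 2 ^ (j + 1) = 2 * 2 ^ j := by ring
    have e2 : 2 ^ (j + 1 + 1) = 2 * 2 ^ (j + 1) := by ring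
    simp only [List.foldl_cons]
    refine ih (f s b) (j + 1) ?_ ?_ (by omega)
    · rw [hc]; split_ifs <;> omega
    · rw [hc]; split_ifs <;> omega

theorem aux_main (d : ℕ) (hd : 1 ≤ d) (f : ℕ → Bool → ℕ)
    (hf : ∀ s b, ∃ c, f s b = delta d s c)
    (hl : ∀ s b, 2 ^ d ≤ s + 1 → f s b = f 0 b)
    (x : ℕ) (u : List Bool) (s : ℕ) (hs : ∀ b, f s b = f 0 b) (hu : u.length = d * x) :
    ∀ b, f (u.foldl f s) b = f 0 b := by
  induction x generalizing u s with
  | zero =>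
    have : u = [] := by simpa using hu
    subst this
    simpa using hs
  | succ x ih =>
    rw [Nat.mul_succ] at hu
    rw [← List.take_append_drop d u, List.foldl_append]
    refine ih _ _ ?_ (by simp; omega)
    intro b
    apply hl
    have hlen : (u.take d).length = d := by simp; omega
    have h0 : (u.take d).foldl f s = (u.take d).foldl f 0 := by
      cases h : u.take d with
      | nil => rw [h] at hlen; simp at hlen; omega
      | cons a t => simp [hs]
    rw [h0]
    exact aux_level d f hf _ 0 0 (by norm_num) (by norm_num) (by omega)

theorem aux_delta_leaf (d : ℕ) (s : ℕ) (b : Bool) (h : 2 ^ d ≤ s + 1) :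
    delta d s b = delta d 0 b := by
  have : ¬ (s + 1 < 2 ^ d) := by omega
  simp [delta, this]

/-- the output of the cyclic tree automaton of depth `d` on a
concatenation `u ++ v`, where `u` has length `d*x` with `x ≥ 1`, is the
concatenation of the outputs on `u` and on `v`; and the same holds for every
pruned automaton with `1 ≤ i ≤ 2^(d+1) - 2`. -/
theorem stmt4 (d x : ℕ) (hd : 1 ≤ d) (hx : 1 ≤ x)
    (ℓ : ℕ → Bool) (u v : List Bool) (hu : u.length = d * x) :
    out d ℓ (u ++ v) = out d ℓ u ++ out d ℓ v ∧
    ∀ i : ℕ, 1 ≤ i → i ≤ 2 ^ (d + 1) - 2 →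
      outP d i ℓ (u ++ v) = outP d i ℓ u ++ outP d i ℓ v := by
  constructor
  · unfold out
    rw [aux_visited_append, List.map_append]
    congr 2
    exact aux_visited_congr _ _ _ _ (aux_main d hd (delta d) (fun s b => ⟨b, rfl⟩)
      (aux_delta_leaf d) x u 0 (fun _ => rfl) hu)
  · intro i _ _
    unfold outP
    rw [aux_visited_append, List.map_append]
    congr 2
    refine aux_visited_congr _ _ _ _ (aux_main d hd (deltaP d i) ?_ ?_ x u 0 (fun _ => rfl) hu)
    · intro s b
      unfold deltaP
      split_ifs
      · exact ⟨_, rfl⟩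
      · exact ⟨_, rfl⟩
    · intro s b h
      simp only [deltaP, aux_delta_leaf d s _ h]
end
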